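/- Let n ≥ 2 and let x_1,…,x_n, e_1,…,e_n, a, b be real numbers with y_i = a + b x_i + e_i. Write x̄ = (1/n)Σ x_i, ē = (1/n)Σ e_i, x_i^0 = x_i − x̄, e_i^0 = e_i − ē, and assume (1/n)Σ (x_i^0)² > 0. Let b̂ = ((1/n)Σ x_i y_i − x̄·(1/n)Σ y_i)/((1/n)Σ x_i² − x̄²), â = (1/n)Σ y_i − b̂ x̄, ê_i = y_i − â − b̂ x_i, and define Δ̂_k = Σ_{i=1}^k ( e_i − ((1/n)Σ_{j=1}^n x_j^0 e_j^0 / (1/n)Σ_{j=1}^n (x_j^0)²) · x_i ) and Δ̂_k^0 = Σ_{i=1}^k ê_i. Then for every 1 ≤ k ≤ n: Δ̂_k^0 = Δ̂_k − (k/n)·Δ̂_n. -/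

import Mathlib

open Finset

noncomputable section

/-- Least-squares slope `b̂ = (mean(xy) − mean(x)mean(y)) / (mean(x²) − mean(x)²)`. -/
def olsSlope (n : ℕ) (x y : ℕ → ℝ) : ℝ :=
  ((∑ i ∈ Finset.range n, x i * y i) / n -
      ((∑ i ∈ Finset.range n, x i) / n) * ((∑ i ∈ Finset.range n, y i) / n)) /
    ((∑ i ∈ Finset.range n, (x i) ^ 2) / n - ((∑ i ∈ Finset.range n, x i) / n) ^ 2)

/-- Least-squares intercept `â = ȳ − b̂ x̄`. -/
def olsIntercept (n : ℕ) (x y : ℕ → ℝ) : ℝ :=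
  (∑ i ∈ Finset.range n, y i) / n - olsSlope n x y * ((∑ i ∈ Finset.range n, x i) / n)

/-- Least-squares residual `ê_i = y_i − â − b̂ x_i`. -/
def olsResidual (n : ℕ) (x y : ℕ → ℝ) (i : ℕ) : ℝ :=
  y i - olsIntercept n x y - olsSlope n x y * x i

/-- The centred and uncentred forms of the empirical covariance agree. -/
theorem sum_centered_mul_centered_div {n : ℕ} (hn : (n : ℝ) ≠ 0) (u v : ℕ → ℝ) :
    (∑ j ∈ Finset.range n, (u j - (∑ l ∈ Finset.range n, u l) / n) *
        (v j - (∑ l ∈ Finset.range n, v l) / n)) / n =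
      (∑ i ∈ Finset.range n, u i * v i) / n -
        ((∑ i ∈ Finset.range n, u i) / n) * ((∑ i ∈ Finset.range n, v i) / n) := by
  simp only [sub_mul, mul_sub, Finset.sum_sub_distrib, ← Finset.sum_mul, ← Finset.mul_sum,
    Finset.sum_const, Finset.card_range, nsmul_eq_mul]
  field_simp
  ring

/-- The empirical variance as a mean of squares minus the square of the mean. -/
theorem sum_centered_sq_div {n : ℕ} (hn : (n : ℝ) ≠ 0) (u : ℕ → ℝ) :
    (∑ j ∈ Finset.range n, (u j - (∑ l ∈ Finset.range n, u l) / n) ^ 2) / n =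
      (∑ i ∈ Finset.range n, (u i) ^ 2) / n - ((∑ i ∈ Finset.range n, u i) / n) ^ 2 := by
  simpa only [sq] using sum_centered_mul_centered_div hn u u

/-- The sample mean of the responses in the linear model. -/
theorem mean_response {n : ℕ} (hn : (n : ℝ) ≠ 0) {x e y : ℕ → ℝ} {a b : ℝ}
    (hy : ∀ i ∈ Finset.range n, y i = a + b * x i + e i) :
    (∑ i ∈ Finset.range n, y i) / n =
      a + b * ((∑ i ∈ Finset.range n, x i) / n) + (∑ i ∈ Finset.range n, e i) / n := by
  rw [Finset.sum_congr rfl hy]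
  simp only [Finset.sum_add_distrib, ← Finset.mul_sum, Finset.sum_const, Finset.card_range,
    nsmul_eq_mul]
  field_simp

/-- The estimation error of the slope is the regression coefficient of the errors on `x`. -/
theorem olsSlope_eq {n : ℕ} (hn : (n : ℝ) ≠ 0) {x e y : ℕ → ℝ} {a b : ℝ}
    (hy : ∀ i ∈ Finset.range n, y i = a + b * x i + e i)
    (hvar : (∑ i ∈ Finset.range n, (x i - (∑ j ∈ Finset.range n, x j) / n) ^ 2) / n ≠ 0) :
    olsSlope n x y = b +
      (∑ j ∈ Finset.range n, (x j - (∑ l ∈ Finset.range n, x l) / n) *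
          (e j - (∑ l ∈ Finset.range n, e l) / n)) / n /
        ((∑ j ∈ Finset.range n, (x j - (∑ l ∈ Finset.range n, x l) / n) ^ 2) / n) := by
  have hxy : ∑ i ∈ Finset.range n, x i * y i =
      a * ∑ i ∈ Finset.range n, x i + b * ∑ i ∈ Finset.range n, x i ^ 2 +
        ∑ i ∈ Finset.range n, x i * e i := by
    simp only [Finset.mul_sum, ← Finset.sum_add_distrib]
    refine Finset.sum_congr rfl fun i hi => ?_
    rw [hy i hi]
    ring
  rw [sum_centered_sq_div hn] at hvar
  rw [olsSlope, sum_centered_mul_centered_div hn, sum_centered_sq_div hn, mean_response hn hy, hxy,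
    div_eq_iff hvar, add_mul, div_mul_cancel₀ _ hvar]
  ring

/-- With `Δ̂_k = Σ_{i≤k} (e_i − (Σ x_j⁰e_j⁰ / Σ (x_j⁰)²) x_i)` and
`Δ̂⁰_k = Σ_{i≤k} ê_i`, one has `Δ̂⁰_k = Δ̂_k − (k/n) Δ̂_n`. -/
theorem partial_sum_residuals_bridge
    (n : ℕ) (hn : 2 ≤ n) (x e y : ℕ → ℝ) (a b : ℝ)
    (hy : ∀ i ∈ Finset.range n, y i = a + b * x i + e i)
    (hvar : 0 < (∑ i ∈ Finset.range n, (x i - (∑ j ∈ Finset.range n, x j) / n) ^ 2) / n)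
    (Δ : ℕ → ℝ)
    (hΔ : ∀ k, Δ k = ∑ i ∈ Finset.range k,
      (e i -
        ((∑ j ∈ Finset.range n, (x j - (∑ l ∈ Finset.range n, x l) / n) *
            (e j - (∑ l ∈ Finset.range n, e l) / n)) / n /
          ((∑ j ∈ Finset.range n, (x j - (∑ l ∈ Finset.range n, x l) / n) ^ 2) / n)) * x i)) :
    ∀ k, 1 ≤ k → k ≤ n →
      ∑ i ∈ Finset.range k, olsResidual n x y i = Δ k - ((k : ℝ) / n) * Δ n := by
  intro k _ hk
  have hn0 : (n : ℝ) ≠ 0 := by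
    have : n ≠ 0 := by omega
    exact_mod_cast this
  have hslope := olsSlope_eq hn0 hy hvar.ne'
  set θ := (∑ j ∈ Finset.range n, (x j - (∑ l ∈ Finset.range n, x l) / n) *
      (e j - (∑ l ∈ Finset.range n, e l) / n)) / n /
    ((∑ j ∈ Finset.range n, (x j - (∑ l ∈ Finset.range n, x l) / n) ^ 2) / n)
  have hres : ∀ i ∈ Finset.range k, olsResidual n x y i = (e i - θ * x i) - Δ n / n := by
    intro i hi
    rw [olsResidual, olsIntercept, hslope, mean_response hn0 hy,
      hy i (Finset.range_subset_range.2 hk hi), hΔ n, Finset.sum_sub_distrib, ← Finset.mul_sum]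
    ring
  rw [Finset.sum_congr rfl hres, Finset.sum_sub_distrib, ← hΔ k, Finset.sum_const,
    Finset.card_range, nsmul_eq_mul]
  ring
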